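/- For every real s ≠ 0, the matrix Q(s) defines a bounded linear operator on ℓ²(ℕ∪{0}) whose operator norm satisfies ‖Q(s)‖ ≤ π/2 + 12·|s| + (1/2)·|s|·(1+|s|)^{(3+|s|)/2}. -/

import Mathlib

/-- `γ_n(s) = (Γ(n+|s|+1)/n!)^{1/2}`. -/
noncomputable def gammaCoef (s : ℝ) (n : ℕ) : ℝ :=
  Real.sqrt (Real.Gamma ((n : ℝ) + |s| + 1) / (Nat.factorial n : ℝ))

/-- The matrix `Q(s)`, indexed by `m, n ∈ ℕ ∪ {0}`. -/
noncomputable def Qmat (s : ℝ) (m n : ℕ) : ℂ :=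
  if m = n then 0
  else (Complex.I * (Real.sign s : ℝ) / (2 * (((n : ℝ) : ℂ) - ((m : ℝ) : ℂ)))) *
    ((min (gammaCoef s m / gammaCoef s n) (gammaCoef s n / gammaCoef s m) : ℝ) : ℂ)

/-- The fourth root of `n + 1/2`. -/
noncomputable def quarticRoot (n : ℕ) : ℝ := ((n : ℝ) + 1 / 2) ^ (1 / 4 : ℝ)

lemma quarticRoot_pos (n : ℕ) : 0 < quarticRoot n := by
  unfold quarticRoot; positivity

lemma quarticRoot_pow_four (n : ℕ) : quarticRoot n ^ 4 = n + 1 / 2 := by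
  unfold quarticRoot
  rw [← Real.rpow_natCast, ← Real.rpow_mul (by positivity)]
  norm_num

lemma quarticRoot_mono : Monotone quarticRoot := by
  intro m n h
  unfold quarticRoot
  gcongr

lemma quarticRoot_succ_pow_four (n : ℕ) : quarticRoot (n + 1) ^ 4 = quarticRoot n ^ 4 + 1 := by
  rw [quarticRoot_pow_four, quarticRoot_pow_four]; push_cast; ring

lemma inv_quarticRoot_cube_le (n : ℕ) :
    (quarticRoot n ^ 3)⁻¹ ≤ 8 * (quarticRoot (n + 1) - quarticRoot n) := by
  have hu := quarticRoot_pos n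
  have huv := quarticRoot_mono n.le_succ
  have h4 := quarticRoot_succ_pow_four n
  have hlow : (1 : ℝ) / 2 ≤ quarticRoot n ^ 4 := by rw [quarticRoot_pow_four]; simp
  simp only [Nat.succ_eq_add_one] at huv
  set u := quarticRoot n
  set v := quarticRoot (n + 1)
  have hv : v ≤ 7 / 5 * u := by
    refine le_of_pow_le_pow_left₀ (n := 4) (by norm_num) (by positivity) ?_
    rw [mul_pow, h4]; linarith
  have hprod : (v + u) * (v ^ 2 + u ^ 2) ≤ 8 * u ^ 3 := by
    calc (v + u) * (v ^ 2 + u ^ 2)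
        ≤ (7 / 5 * u + u) * ((7 / 5 * u) ^ 2 + u ^ 2) := by gcongr; linarith
      _ ≤ 8 * u ^ 3 := by nlinarith [pow_pos hu 3]
  rw [inv_le_iff_one_le_mul₀ (by positivity)]
  calc 1 = (v - u) * ((v + u) * (v ^ 2 + u ^ 2)) := by linear_combination -h4
    _ ≤ (v - u) * (8 * u ^ 3) := by gcongr
    _ = _ := by ring

lemma inv_quarticRoot_succ_pow_five_le (n : ℕ) :
    (quarticRoot (n + 1) ^ 5)⁻¹ ≤ 4 * ((quarticRoot n)⁻¹ - (quarticRoot (n + 1))⁻¹) := by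
  have hu := quarticRoot_pos n
  have hv := quarticRoot_pos (n + 1)
  have huv := quarticRoot_mono n.le_succ
  have h4 := quarticRoot_succ_pow_four n
  simp only [Nat.succ_eq_add_one] at huv
  set u := quarticRoot n
  set v := quarticRoot (n + 1)
  have hprod : u * ((v + u) * (v ^ 2 + u ^ 2)) ≤ 4 * v ^ 4 := by
    calc u * ((v + u) * (v ^ 2 + u ^ 2)) ≤ v * ((v + v) * (v ^ 2 + v ^ 2)) := by gcongr
      _ = 4 * v ^ 4 := by ring
  have hd : 0 ≤ v - u := by linarith
  have key : u ≤ 4 * v ^ 4 * (v - u) := by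
    calc u = (v - u) * (u * ((v + u) * (v ^ 2 + u ^ 2))) := by linear_combination -u * h4
      _ ≤ (v - u) * (4 * v ^ 4) := by gcongr
      _ = _ := by ring
  have e : 4 * (u⁻¹ - v⁻¹) - (v ^ 5)⁻¹ = (4 * v ^ 4 * (v - u) - u) / (u * v ^ 5) := by
    field_simp
  have : 0 ≤ (4 * v ^ 4 * (v - u) - u) / (u * v ^ 5) :=
    div_nonneg (by linarith) (by positivity)
  linarith

lemma one_div_succ_le_quarticRoot (n : ℕ) :
    1 / ((n : ℝ) + 1) ≤ 4 * (quarticRoot (n + 1) / quarticRoot n - 1) := by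
  have hu := quarticRoot_pos n
  have huv := quarticRoot_mono n.le_succ
  have h4 := quarticRoot_succ_pow_four n
  have hn := quarticRoot_pow_four n
  simp only [Nat.succ_eq_add_one] at huv
  set u := quarticRoot n
  set v := quarticRoot (n + 1)
  have hd : 0 ≤ v - u := by linarith
  have hprod : 2 * u * ((v + u) * (v ^ 2 + u ^ 2)) ≤ 4 * (v ^ 4 + u ^ 4) := by
    have hv : 0 ≤ v := hu.le.trans huv
    have h1 : 0 ≤ (v - u) * (2 * v ^ 3 + u * ((v - u) * (v + u))) := by positivity
    linarith
  have hsum : (n : ℝ) + 1 = (v ^ 4 + u ^ 4) / 2 := by linarith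
  rw [hsum, div_le_iff₀ (by positivity)]
  have e : 4 * (v / u - 1) * ((v ^ 4 + u ^ 4) / 2)
      = (v - u) * (4 * (v ^ 4 + u ^ 4)) / (2 * u) := by field_simp
  rw [e, le_div_iff₀ (by positivity)]
  calc 1 * (2 * u) = (v - u) * (2 * u * ((v + u) * (v ^ 2 + u ^ 2))) := by
        linear_combination -2 * u * h4
    _ ≤ _ := by gcongr

lemma sum_inv_quarticRoot_cube_le (m N : ℕ) :
    ∑ n ∈ Finset.range N, (if n < m then (quarticRoot n ^ 3)⁻¹ else 0)
      ≤ 8 * quarticRoot m := by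
  have h : ∑ n ∈ Finset.range N, (if n < m then (quarticRoot n ^ 3)⁻¹ else 0)
      ≤ 8 * quarticRoot (min N m) := by
    induction N with
    | zero => simpa using (quarticRoot_pos 0).le
    | succ k ih =>
      rw [Finset.sum_range_succ]
      by_cases hk : k < m
      · rw [min_eq_left hk.le] at ih
        rw [min_eq_left hk, if_pos hk]
        linarith [inv_quarticRoot_cube_le k]
      · rw [min_eq_right (by omega)] at ih ⊢
        simpa [hk] using ih
  have := quarticRoot_mono (min_le_right N m)
  linarith

lemma sum_inv_quarticRoot_pow_five_le (m N : ℕ) :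
    ∑ n ∈ Finset.range N, (if m < n then (quarticRoot n ^ 5)⁻¹ else 0)
      ≤ 4 * (quarticRoot m)⁻¹ := by
  have h (k : ℕ) : ∑ n ∈ Finset.range (k + 1), (if m < n then (quarticRoot n ^ 5)⁻¹ else 0)
      ≤ 4 * ((quarticRoot m)⁻¹ - (quarticRoot (max m k))⁻¹) := by
    induction k with
    | zero => simp
    | succ k ih =>
      rw [Finset.sum_range_succ]
      by_cases hk : m < k + 1
      · rw [max_eq_right (by omega)] at ih ⊢
        rw [if_pos hk]
        linarith [inv_quarticRoot_succ_pow_five_le k]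
      · rw [max_eq_left (by omega)] at ih ⊢
        simpa [hk] using ih
  rcases N with _ | k
  · simpa using (quarticRoot_pos m).le
  · have := inv_pos.2 (quarticRoot_pos (max m k))
    linarith [h k]

/-- A symmetric kernel with zero diagonal, homogeneous of degree `-1` in `n + 1/2`. -/
noncomputable def rootKernel (m n : ℕ) : ℝ :=
  if n < m then (quarticRoot n * quarticRoot m ^ 3)⁻¹
  else if m < n then (quarticRoot m * quarticRoot n ^ 3)⁻¹ else 0

lemma rootKernel_comm (m n : ℕ) : rootKernel m n = rootKernel n m := by
  unfold rootKernel; grind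

lemma sum_rootKernel_mul_le (m N : ℕ) :
    ∑ n ∈ Finset.range N, rootKernel m n * (quarticRoot n ^ 2)⁻¹
      ≤ 12 * (quarticRoot m ^ 2)⁻¹ := by
  have hm := quarticRoot_pos m
  have hterm (n : ℕ) : rootKernel m n * (quarticRoot n ^ 2)⁻¹ =
      (quarticRoot m ^ 3)⁻¹ * (if n < m then (quarticRoot n ^ 3)⁻¹ else 0) +
      (quarticRoot m)⁻¹ * (if m < n then (quarticRoot n ^ 5)⁻¹ else 0) := by
    have hn := quarticRoot_pos n
    unfold rootKernel
    split_ifs <;> first | omega | (field_simp; try simp)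
  simp_rw [hterm, Finset.sum_add_distrib, ← Finset.mul_sum]
  calc _ ≤ (quarticRoot m ^ 3)⁻¹ * (8 * quarticRoot m) +
        (quarticRoot m)⁻¹ * (4 * (quarticRoot m)⁻¹) := by
        gcongr
        exacts [sum_inv_quarticRoot_cube_le m N, sum_inv_quarticRoot_pow_five_le m N]
    _ = _ := by field_simp; norm_num

lemma gammaCoef_pos (s : ℝ) (n : ℕ) : 0 < gammaCoef s n := by
  unfold gammaCoef
  have := Real.Gamma_pos_of_pos (s := (n : ℝ) + |s| + 1) (by positivity)
  positivity

lemma gammaCoef_succ_sq (s : ℝ) (n : ℕ) :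
    gammaCoef s (n + 1) ^ 2 = (1 + |s| / (n + 1)) * gammaCoef s n ^ 2 := by
  have h0 := Real.Gamma_pos_of_pos (s := (n : ℝ) + |s| + 1) (by positivity)
  have hG : Real.Gamma (((n + 1 : ℕ) : ℝ) + |s| + 1)
      = (n + |s| + 1) * Real.Gamma ((n : ℝ) + |s| + 1) := by
    rw [← Real.Gamma_add_one (by positivity)]; congr 1; push_cast; ring
  unfold gammaCoef
  rw [hG, Real.sq_sqrt (by positivity), Real.sq_sqrt (by positivity), Nat.factorial_succ]
  push_cast
  field_simp
  ring

lemma gammaCoef_mono (s : ℝ) : Monotone (gammaCoef s) := by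
  refine monotone_nat_of_le_succ fun n => ?_
  refine le_of_pow_le_pow_left₀ (n := 2) (by norm_num) (gammaCoef_pos s _).le ?_
  rw [gammaCoef_succ_sq]
  have : 0 ≤ |s| / ((n : ℝ) + 1) := by positivity
  nlinarith [sq_nonneg (gammaCoef s n)]

lemma one_sub_gammaCoef_div_succ_le (s : ℝ) (n : ℕ) :
    1 - gammaCoef s n / gammaCoef s (n + 1) ≤ |s| / 2 * (1 / ((n : ℝ) + 1)) := by
  have hg := gammaCoef_pos s n
  have hg' := gammaCoef_pos s (n + 1)
  have hle := gammaCoef_mono s n.le_succ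
  have hsq := gammaCoef_succ_sq s n
  simp only [Nat.succ_eq_add_one] at hle
  set g := gammaCoef s n
  set g' := gammaCoef s (n + 1)
  have ht : |s| / ((n : ℝ) + 1) = (g' ^ 2 - g ^ 2) / g ^ 2 := by
    field_simp at hsq ⊢; linarith
  have e : |s| / 2 * (1 / ((n : ℝ) + 1)) = (g' ^ 2 - g ^ 2) / g ^ 2 / 2 := by
    rw [← ht]; ring
  have e' : (g' ^ 2 - g ^ 2) / g ^ 2 / 2 - (1 - g / g')
      = (g' - g) * (g' * (g' + g) - 2 * g ^ 2) / (2 * g ^ 2 * g') := by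
    field_simp; ring
  have : 0 ≤ (g' - g) * (g' * (g' + g) - 2 * g ^ 2) / (2 * g ^ 2 * g') :=
    div_nonneg (mul_nonneg (by linarith) (by nlinarith)) (by positivity)
  linarith

lemma one_sub_gammaCoef_div_le (s : ℝ) {m n : ℕ} (h : m ≤ n) :
    1 - gammaCoef s m / gammaCoef s n ≤ 2 * |s| * (quarticRoot n / quarticRoot m - 1) := by
  have hum := quarticRoot_pos m
  have hgm := gammaCoef_pos s m
  induction n, h using Nat.le_induction with
  | base => rw [div_self hum.ne', div_self hgm.ne']; simp
  | succ n hmn ih =>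
    have hun := quarticRoot_pos n
    have hgn := gammaCoef_pos s n
    have hgn' := gammaCoef_pos s (n + 1)
    have hρ : gammaCoef s m / gammaCoef s n ≤ 1 := (div_le_one hgn).2 (gammaCoef_mono s hmn)
    have hr : gammaCoef s n / gammaCoef s (n + 1) ≤ 1 :=
      (div_le_one hgn').2 (gammaCoef_mono s n.le_succ)
    have hprod : gammaCoef s m / gammaCoef s (n + 1)
        = gammaCoef s m / gammaCoef s n * (gammaCoef s n / gammaCoef s (n + 1)) := by
      field_simp
    have hstep : |s| / 2 * (1 / ((n : ℝ) + 1))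
        ≤ 2 * |s| * ((quarticRoot (n + 1) - quarticRoot n) / quarticRoot m) := by
      have h1 := one_div_succ_le_quarticRoot n
      have h2 : quarticRoot (n + 1) / quarticRoot n - 1
          ≤ (quarticRoot (n + 1) - quarticRoot n) / quarticRoot m := by
        rw [div_sub_one hun.ne']
        have := quarticRoot_mono hmn
        have := quarticRoot_mono n.le_succ
        gcongr
      calc _ ≤ |s| / 2 * (4 * ((quarticRoot (n + 1) - quarticRoot n) / quarticRoot m)) := by
            gcongr; linarith
        _ = _ := by ring
    have hlast := one_sub_gammaCoef_div_succ_le s n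
    have hdiv : 2 * |s| * (quarticRoot (n + 1) / quarticRoot m - 1)
        = 2 * |s| * (quarticRoot n / quarticRoot m - 1)
          + 2 * |s| * ((quarticRoot (n + 1) - quarticRoot n) / quarticRoot m) := by ring
    rw [hprod, hdiv]
    nlinarith [mul_nonneg (sub_nonneg.2 hρ) (sub_nonneg.2 hr)]

/-- The ratio `min (γ_m/γ_n) (γ_n/γ_m)`. -/
noncomputable def gammaRatio (s : ℝ) (m n : ℕ) : ℝ :=
  min (gammaCoef s m / gammaCoef s n) (gammaCoef s n / gammaCoef s m)

lemma gammaRatio_comm (s : ℝ) (m n : ℕ) : gammaRatio s m n = gammaRatio s n m := min_comm _ _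

lemma gammaRatio_of_le (s : ℝ) {m n : ℕ} (h : m ≤ n) :
    gammaRatio s m n = gammaCoef s m / gammaCoef s n := by
  have hm := gammaCoef_pos s m
  have hn := gammaCoef_pos s n
  have hle := gammaCoef_mono s h
  exact min_eq_left (((div_le_one hn).2 hle).trans ((one_le_div hm).2 hle))

lemma one_sub_gammaRatio_div_le (s : ℝ) (m n : ℕ) :
    |(1 - gammaRatio s m n) / (2 * ((n : ℝ) - m))| ≤ |s| * rootKernel m n := by
  wlog h : m ≤ n generalizing m n
  · have := this n m (by omega)
    rw [rootKernel_comm, gammaRatio_comm]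
    rwa [← abs_neg, ← div_neg, show -(2 * ((n : ℝ) - m)) = 2 * ((m : ℝ) - n) by ring]
  rcases h.eq_or_lt with rfl | hlt
  · simp [rootKernel]
  have hum := quarticRoot_pos m
  have hun := quarticRoot_pos n
  have hmono := quarticRoot_mono h
  have hnm : (n : ℝ) - m = quarticRoot n ^ 4 - quarticRoot m ^ 4 := by
    rw [quarticRoot_pow_four, quarticRoot_pow_four]; ring
  have hpos : 0 < (n : ℝ) - m := by
    have : (m : ℝ) < n := by exact_mod_cast hlt
    linarith
  have hρ : gammaCoef s m / gammaCoef s n ≤ 1 :=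
    (div_le_one (gammaCoef_pos s n)).2 (gammaCoef_mono s h)
  have hb := one_sub_gammaCoef_div_le s h
  rw [gammaRatio_of_le s h, abs_of_nonneg (div_nonneg (by linarith) (by positivity)),
    rootKernel, if_neg (by omega), if_pos hlt, div_le_iff₀ (by positivity), hnm]
  refine hb.trans ?_
  set u := quarticRoot m
  set v := quarticRoot n
  have hd : 0 ≤ v - u := by linarith
  have e : |s| * (u * v ^ 3)⁻¹ * (2 * (v ^ 4 - u ^ 4)) - 2 * |s| * (v / u - 1)
      = 2 * |s| * ((v - u) * (u * v ^ 2 + u ^ 2 * v + u ^ 3)) / (u * v ^ 3) := by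
    field_simp; ring
  have : 0 ≤ 2 * |s| * ((v - u) * (u * v ^ 2 + u ^ 2 * v + u ^ 3)) / (u * v ^ 3) := by positivity
  linarith

open scoped ComplexConjugate in
/-- The matrix `A` satisfies `|⟨y, A x⟩| ≤ C (‖x‖² + ‖y‖²) / 2` for finitely supported `x`, `y`. -/
def FormBound (A : ℕ → ℕ → ℂ) (C : ℝ) : Prop :=
  ∀ (N : ℕ) (x y : ℕ → ℂ),
    ‖∑ m ∈ Finset.range N, ∑ n ∈ Finset.range N, conj (y m) * A m n * x n‖
      ≤ C / 2 * (∑ m ∈ Finset.range N, ‖y m‖ ^ 2 + ∑ n ∈ Finset.range N, ‖x n‖ ^ 2)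

lemma FormBound.add {A B : ℕ → ℕ → ℂ} {C D : ℝ} (hA : FormBound A C) (hB : FormBound B D) :
    FormBound (fun m n => A m n + B m n) (C + D) := by
  intro N x y
  simp_rw [mul_add, add_mul, Finset.sum_add_distrib]
  refine (norm_add_le _ _).trans ?_
  linarith [hA N x y, hB N x y]

lemma FormBound.const_mul {A : ℕ → ℕ → ℂ} {C : ℝ} (hA : FormBound A C) (c : ℂ) :
    FormBound (fun m n => c * A m n) (‖c‖ * C) := by
  intro N x y
  have : ∑ m ∈ Finset.range N, ∑ n ∈ Finset.range N, (starRingEnd ℂ) (y m) * (c * A m n) * x n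
      = c * ∑ m ∈ Finset.range N, ∑ n ∈ Finset.range N, (starRingEnd ℂ) (y m) * A m n * x n := by
    simp_rw [Finset.mul_sum]
    refine Finset.sum_congr rfl fun m _ => Finset.sum_congr rfl fun n _ => by ring
  rw [this, norm_mul]
  calc _ ≤ ‖c‖ * _ := mul_le_mul_of_nonneg_left (hA N x y) (norm_nonneg c)
    _ = _ := by ring

/-- The Schur test for matrices dominated by a symmetric kernel. -/
lemma FormBound.of_schur {A : ℕ → ℕ → ℂ} {K : ℕ → ℕ → ℝ} {p : ℕ → ℝ} {C : ℝ}
    (hp : ∀ n, 0 < p n) (hK : ∀ m n, K m n = K n m) (hAK : ∀ m n, ‖A m n‖ ≤ K m n)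
    (hsum : ∀ m N, ∑ n ∈ Finset.range N, K m n * p n ≤ C * p m) : FormBound A C := by
  intro N x y
  have hK0 (m n : ℕ) : 0 ≤ K m n := (norm_nonneg _).trans (hAK m n)
  have half (z : ℕ → ℂ) :
      ∑ m ∈ Finset.range N, ∑ n ∈ Finset.range N, K m n * (p n / p m * ‖z m‖ ^ 2)
        ≤ C * ∑ m ∈ Finset.range N, ‖z m‖ ^ 2 := by
    rw [Finset.mul_sum]
    refine Finset.sum_le_sum fun m _ => ?_
    have : ∑ n ∈ Finset.range N, K m n * (p n / p m * ‖z m‖ ^ 2)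
        = (∑ n ∈ Finset.range N, K m n * p n) / p m * ‖z m‖ ^ 2 := by
      rw [Finset.sum_div, Finset.sum_mul]
      exact Finset.sum_congr rfl fun n _ => by ring
    rw [this]
    gcongr
    exact (div_le_iff₀ (hp m)).2 (hsum m N)
  have hterm (m n : ℕ) : ‖(starRingEnd ℂ) (y m) * A m n * x n‖
      ≤ (K m n * (p n / p m * ‖y m‖ ^ 2) + K n m * (p m / p n * ‖x n‖ ^ 2)) / 2 := by
    rw [norm_mul, norm_mul, RCLike.norm_conj, hK n m]
    have hm := hp m
    have hn := hp n
    have amgm : ‖y m‖ * ‖x n‖ ≤ (p n / p m * ‖y m‖ ^ 2 + p m / p n * ‖x n‖ ^ 2) / 2 := by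
      have e : (p n / p m * ‖y m‖ ^ 2 + p m / p n * ‖x n‖ ^ 2) / 2 - ‖y m‖ * ‖x n‖
          = (p n * ‖y m‖ - p m * ‖x n‖) ^ 2 / (2 * (p m * p n)) := by
        field_simp; ring
      have : 0 ≤ (p n * ‖y m‖ - p m * ‖x n‖) ^ 2 / (2 * (p m * p n)) := by positivity
      linarith
    calc ‖y m‖ * ‖A m n‖ * ‖x n‖ = ‖A m n‖ * (‖y m‖ * ‖x n‖) := by ring
      _ ≤ K m n * ((p n / p m * ‖y m‖ ^ 2 + p m / p n * ‖x n‖ ^ 2) / 2) :=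
        mul_le_mul (hAK m n) amgm (by positivity) (hK0 m n)
      _ = _ := by ring
  calc _ ≤ ∑ m ∈ Finset.range N, ∑ n ∈ Finset.range N,
        (K m n * (p n / p m * ‖y m‖ ^ 2) + K n m * (p m / p n * ‖x n‖ ^ 2)) / 2 :=
        norm_sum_le_of_le _ fun m _ => norm_sum_le_of_le _ fun n _ => hterm m n
    _ = (∑ m ∈ Finset.range N, ∑ n ∈ Finset.range N, K m n * (p n / p m * ‖y m‖ ^ 2)
        + ∑ m ∈ Finset.range N, ∑ n ∈ Finset.range N, K m n * (p n / p m * ‖x m‖ ^ 2)) / 2 := by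
        rw [Finset.sum_comm (f := fun m n => K m n * (p n / p m * ‖x m‖ ^ 2))]
        simp_rw [← Finset.sum_div, Finset.sum_add_distrib]
    _ ≤ _ := by linarith [half x, half y]

/-- The character `t ↦ exp (2πikt)`. -/
noncomputable def expChar (k : ℤ) (t : ℝ) : ℂ := Complex.exp (2 * Real.pi * Complex.I * k * t)

lemma continuous_expChar (k : ℤ) : Continuous (expChar k) := by unfold expChar; fun_prop

lemma conj_expChar_mul_expChar (k l : ℤ) (t : ℝ) :
    (starRingEnd ℂ) (expChar k t) * expChar l t = expChar (l - k) t := by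
  unfold expChar
  rw [← Complex.exp_conj, ← Complex.exp_add]
  congr 1
  simp only [map_mul, Complex.conj_I, Complex.conj_ofReal, map_ofNat, Int.cast_sub,
    map_intCast]
  ring

lemma integral_expChar (k : ℤ) : ∫ t in (0 : ℝ)..1, expChar k t = if k = 0 then 1 else 0 := by
  split_ifs with hk
  · simp [expChar, hk]
  · have hc : 2 * (Real.pi : ℂ) * Complex.I * k ≠ 0 := by
      simp [Real.pi_ne_zero, hk]
    unfold expChar
    rw [integral_exp_mul_complex hc]
    have : Complex.exp (2 * Real.pi * Complex.I * k * (1 : ℝ)) = 1 := by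
      rw [Complex.exp_eq_one_iff]; exact ⟨k, by push_cast; ring⟩
    rw [this]; simp

lemma integral_sub_half_mul_expChar (k : ℤ) :
    ∫ t in (0 : ℝ)..1, ((t - 1 / 2 : ℝ) : ℂ) * expChar k t
      = 1 / (2 * Real.pi * Complex.I) * (1 / (k : ℂ)) := by
  have h := bernoulliFourierCoeff_eq one_ne_zero (-k)
  rw [bernoulliFourierCoeff, fourierCoeffOn_eq_integral] at h
  simp only [neg_neg, fourier_coe_apply, bernoulliFun_one, smul_eq_mul] at h
  simp only [expChar]
  simp only [sub_zero, Complex.ofReal_one, div_one, one_smul] at h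
  simp_rw [mul_comm ((_ : ℝ) : ℂ) (Complex.exp _)]
  rw [h]
  push_cast
  simp
  ring

/-- The trigonometric polynomial with coefficients `x 0, …, x (N - 1)`. -/
noncomputable def trigPoly (N : ℕ) (x : ℕ → ℂ) (t : ℝ) : ℂ :=
  ∑ n ∈ Finset.range N, x n * expChar n t

lemma continuous_trigPoly (N : ℕ) (x : ℕ → ℂ) : Continuous (trigPoly N x) :=
  continuous_finsetSum _ fun n _ => continuous_const.mul (continuous_expChar n)

lemma integral_mul_conj_trigPoly_mul_trigPoly (N : ℕ) (x y : ℕ → ℂ) {w : ℝ → ℂ}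
    (hw : Continuous w) :
    ∫ t in (0 : ℝ)..1, w t * ((starRingEnd ℂ) (trigPoly N y t) * trigPoly N x t)
      = ∑ m ∈ Finset.range N, ∑ n ∈ Finset.range N,
        (starRingEnd ℂ) (y m) * (∫ t in (0 : ℝ)..1, w t * expChar ((n : ℤ) - m) t) * x n := by
  have hpt (t : ℝ) : w t * ((starRingEnd ℂ) (trigPoly N y t) * trigPoly N x t)
      = ∑ m ∈ Finset.range N, ∑ n ∈ Finset.range N,
        (starRingEnd ℂ) (y m) * x n * (w t * expChar ((n : ℤ) - m) t) := by
    unfold trigPoly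
    rw [map_sum, Finset.sum_mul_sum, Finset.mul_sum]
    refine Finset.sum_congr rfl fun m _ => ?_
    rw [Finset.mul_sum]
    refine Finset.sum_congr rfl fun n _ => ?_
    rw [← conj_expChar_mul_expChar, map_mul]
    ring
  have hc (m n : ℕ) : Continuous fun t =>
      (starRingEnd ℂ) (y m) * x n * (w t * expChar ((n : ℤ) - m) t) :=
    continuous_const.mul (hw.mul (continuous_expChar _))
  simp_rw [hpt]
  rw [intervalIntegral.integral_finsetSum fun m _ =>
    (continuous_finsetSum _ fun n _ => hc m n).intervalIntegrable _ _]
  refine Finset.sum_congr rfl fun m _ => ?_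
  rw [intervalIntegral.integral_finsetSum fun n _ => (hc m n).intervalIntegrable _ _]
  refine Finset.sum_congr rfl fun n _ => ?_
  rw [intervalIntegral.integral_const_mul]
  ring

lemma integral_norm_sq_trigPoly (N : ℕ) (x : ℕ → ℂ) :
    ∫ t in (0 : ℝ)..1, ‖trigPoly N x t‖ ^ 2 = ∑ n ∈ Finset.range N, ‖x n‖ ^ 2 := by
  have h := integral_mul_conj_trigPoly_mul_trigPoly N x x (w := fun _ => 1) continuous_const
  simp_rw [one_mul, integral_expChar, RCLike.conj_mul, sub_eq_zero, Nat.cast_inj] at h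
  have h2 : ∀ m ∈ Finset.range N, ∑ n ∈ Finset.range N,
      (starRingEnd ℂ) (x m) * (if n = m then (1 : ℂ) else 0) * x n = ((‖x m‖ ^ 2 : ℝ) : ℂ) := by
    intro m hm
    simp_rw [mul_ite, ite_mul, mul_one, mul_zero, zero_mul]
    rw [Finset.sum_ite_eq' , if_pos hm, RCLike.conj_mul]
    push_cast; rfl
  rw [Finset.sum_congr rfl h2] at h
  apply Complex.ofReal_injective
  rw [← intervalIntegral.integral_ofReal]
  push_cast at h ⊢
  exact h

/-- Hilbert's inequality with the sharp constant. -/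
lemma formBound_hilbert : FormBound (fun m n => 1 / ((n : ℂ) - m)) Real.pi := by
  intro N x y
  have h := integral_mul_conj_trigPoly_mul_trigPoly N x y
    (w := fun t => ((t - 1 / 2 : ℝ) : ℂ)) (by fun_prop)
  simp_rw [integral_sub_half_mul_expChar] at h
  push_cast at h
  have hpi : (2 * (Real.pi : ℂ) * Complex.I) ≠ 0 := by simp [Real.pi_ne_zero]
  have hS : ∑ m ∈ Finset.range N, ∑ n ∈ Finset.range N,
      (starRingEnd ℂ) (y m) * (1 / ((n : ℂ) - m)) * x n = 2 * Real.pi * Complex.I *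
      ∫ t in (0 : ℝ)..1, ((t : ℂ) - 1 / 2) *
        ((starRingEnd ℂ) (trigPoly N y t) * trigPoly N x t) := by
    rw [h]
    simp_rw [Finset.mul_sum]
    refine Finset.sum_congr rfl fun m _ => Finset.sum_congr rfl fun n _ => ?_
    field_simp
  have hX := continuous_trigPoly N x
  have hY := continuous_trigPoly N y
  have hI : ‖∫ t in (0 : ℝ)..1, ((t : ℂ) - 1 / 2) *
      ((starRingEnd ℂ) (trigPoly N y t) * trigPoly N x t)‖
      ≤ ∫ t in (0 : ℝ)..1, (‖trigPoly N y t‖ ^ 2 + ‖trigPoly N x t‖ ^ 2) / 4 := by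
    refine intervalIntegral.norm_integral_le_of_norm_le zero_le_one ?_
      (Continuous.intervalIntegrable (by fun_prop) _ _)
    refine Filter.Eventually.of_forall fun t ht => ?_
    rw [norm_mul, norm_mul, RCLike.norm_conj]
    have ht2 : ‖(t : ℂ) - 1 / 2‖ ≤ 1 / 2 := by
      have : (t : ℂ) - 1 / 2 = ((t - 1 / 2 : ℝ) : ℂ) := by push_cast; rfl
      rw [this, Complex.norm_real, Real.norm_eq_abs, abs_le]
      constructor <;> linarith [ht.1, ht.2]
    calc _ ≤ 1 / 2 * ((‖trigPoly N y t‖ ^ 2 + ‖trigPoly N x t‖ ^ 2) / 2) := by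
          gcongr
          nlinarith [sq_nonneg (‖trigPoly N y t‖ - ‖trigPoly N x t‖)]
      _ = _ := by ring
  rw [intervalIntegral.integral_div, intervalIntegral.integral_add
    (Continuous.intervalIntegrable (by fun_prop) _ _)
    (Continuous.intervalIntegrable (by fun_prop) _ _),
    integral_norm_sq_trigPoly, integral_norm_sq_trigPoly] at hI
  rw [hS, norm_mul]
  have hn : ‖(2 * (Real.pi : ℂ) * Complex.I)‖ = 2 * Real.pi := by
    simp [abs_of_pos Real.pi_pos]
  rw [hn]
  calc _ ≤ 2 * Real.pi * _ := mul_le_mul_of_nonneg_left hI (by positivity)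
    _ = _ := by ring

lemma FormBound.sum_norm_sq_apply_le {A : ℕ → ℕ → ℂ} {C : ℝ} (hC : 0 < C) (hA : FormBound A C)
    (N : ℕ) (x : ℕ → ℂ) :
    ∑ m ∈ Finset.range N, ‖∑ n ∈ Finset.range N, A m n * x n‖ ^ 2
      ≤ C ^ 2 * ∑ n ∈ Finset.range N, ‖x n‖ ^ 2 := by
  set z : ℕ → ℂ := fun m => ∑ n ∈ Finset.range N, A m n * x n
  have h := hA N x (fun m => ((C⁻¹ : ℝ) : ℂ) * z m)
  have e : ∑ m ∈ Finset.range N, ∑ n ∈ Finset.range N,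
      (starRingEnd ℂ) (((C⁻¹ : ℝ) : ℂ) * z m) * A m n * x n
      = ((C⁻¹ * ∑ m ∈ Finset.range N, ‖z m‖ ^ 2 : ℝ) : ℂ) := by
    rw [Complex.ofReal_mul, Complex.ofReal_sum, Finset.mul_sum]
    refine Finset.sum_congr rfl fun m _ => ?_
    simp_rw [mul_assoc]
    rw [← Finset.mul_sum, map_mul, Complex.conj_ofReal, mul_assoc, Complex.ofReal_pow]
    congr 1
    exact RCLike.conj_mul (z m)
  rw [e, Complex.norm_real, Real.norm_of_nonneg (by positivity)] at h
  simp_rw [norm_mul, Complex.norm_real, Real.norm_of_nonneg (inv_pos.2 hC).le, mul_pow] at h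
  rw [← Finset.mul_sum] at h
  set Z := ∑ m ∈ Finset.range N, ‖z m‖ ^ 2
  set X := ∑ n ∈ Finset.range N, ‖x n‖ ^ 2
  have h2 := mul_le_mul_of_nonneg_left h (by positivity : 0 ≤ 2 * C)
  have e1 : 2 * C * (C⁻¹ * Z) = 2 * Z := by field_simp
  have e2 : 2 * C * (C / 2 * (C⁻¹ ^ 2 * Z + X)) = Z + C ^ 2 * X := by field_simp
  linarith

lemma FormBound.sum_norm_sq_row_le {A : ℕ → ℕ → ℂ} {C : ℝ} (hC : 0 < C) (hA : FormBound A C)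
    {m N : ℕ} (hm : m < N) : ∑ n ∈ Finset.range N, ‖A m n‖ ^ 2 ≤ C ^ 2 := by
  have h := hA N (fun n => (starRingEnd ℂ) (A m n)) (Pi.single m (C : ℂ))
  have e : ∑ k ∈ Finset.range N, ∑ n ∈ Finset.range N,
      (starRingEnd ℂ) ((Pi.single m (C : ℂ) : ℕ → ℂ) k) * A k n * (starRingEnd ℂ) (A m n)
      = ((C * ∑ n ∈ Finset.range N, ‖A m n‖ ^ 2 : ℝ) : ℂ) := by
    rw [Finset.sum_eq_single_of_mem m (Finset.mem_range.2 hm)]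
    · push_cast
      rw [Finset.mul_sum]
      refine Finset.sum_congr rfl fun n _ => ?_
      rw [Pi.single_eq_same, Complex.conj_ofReal, mul_assoc]
      congr 1
      exact RCLike.mul_conj (A m n)
    · intro k _ hk
      simp [Pi.single_eq_of_ne hk]
  have e' : ∑ k ∈ Finset.range N, ‖(Pi.single m (C : ℂ) : ℕ → ℂ) k‖ ^ 2 = C ^ 2 := by
    rw [Finset.sum_eq_single_of_mem m (Finset.mem_range.2 hm)]
    · simp
    · intro k _ hk
      simp [Pi.single_eq_of_ne hk]
  rw [e, e', Complex.norm_real, Real.norm_of_nonneg (by positivity)] at h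
  simp_rw [RCLike.norm_conj] at h
  set Z := ∑ n ∈ Finset.range N, ‖A m n‖ ^ 2
  have : C * Z ≤ C * C ^ 2 := by linarith
  exact le_of_mul_le_mul_left this hC

lemma FormBound.summable_row {A : ℕ → ℕ → ℂ} {C : ℝ} (hC : 0 < C) (hA : FormBound A C) (m : ℕ) :
    Summable fun n => ‖A m n‖ ^ 2 := by
  refine summable_of_sum_range_le (c := C ^ 2) (fun n => by positivity) fun N => ?_
  refine le_trans ?_ (hA.sum_norm_sq_row_le hC (m := m) (N := N + m + 1) (by omega))
  exact Finset.sum_le_sum_of_subset_of_nonneg (Finset.range_mono (by omega))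
    fun _ _ _ => by positivity

lemma summable_norm_sq_lp (x : lp (fun _ : ℕ => ℂ) 2) : Summable fun n => ‖x n‖ ^ 2 := by
  simpa using (lp.memℓp x).summable (by norm_num)

lemma tsum_norm_sq_lp (x : lp (fun _ : ℕ => ℂ) 2) : ∑' n, ‖x n‖ ^ 2 = ‖x‖ ^ 2 := by
  simpa using (lp.norm_rpow_eq_tsum (by norm_num) x).symm

lemma FormBound.summable_mul {A : ℕ → ℕ → ℂ} {C : ℝ} (hC : 0 < C) (hA : FormBound A C) (m : ℕ)
    (x : lp (fun _ : ℕ => ℂ) 2) : Summable fun n => A m n * x n := by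
  refine Summable.of_norm_bounded ((hA.summable_row hC m).add (summable_norm_sq_lp x)) fun n => ?_
  rw [norm_mul]
  nlinarith [sq_nonneg (‖A m n‖ - ‖x n‖), sq_nonneg ‖A m n‖, sq_nonneg ‖x n‖]

lemma FormBound.sum_norm_sq_tsum_le {A : ℕ → ℕ → ℂ} {C : ℝ} (hC : 0 < C) (hA : FormBound A C)
    (x : lp (fun _ : ℕ => ℂ) 2) (S : Finset ℕ) :
    ∑ m ∈ S, ‖∑' n, A m n * x n‖ ^ 2 ≤ (C * ‖x‖) ^ 2 := by
  have hlim : Filter.Tendsto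
      (fun N => ∑ m ∈ S, ‖∑ n ∈ Finset.range N, A m n * x n‖ ^ 2) Filter.atTop
      (nhds (∑ m ∈ S, ‖∑' n, A m n * x n‖ ^ 2)) :=
    tendsto_finsetSum _ fun m _ =>
      ((hA.summable_mul hC m x).hasSum.tendsto_sum_nat.norm.pow 2)
  obtain ⟨M, hM⟩ := S.exists_nat_subset_range
  refine le_of_tendsto hlim (Filter.eventually_atTop.2 ⟨M, fun N hN => ?_⟩)
  calc _ ≤ ∑ m ∈ Finset.range N, ‖∑ n ∈ Finset.range N, A m n * x n‖ ^ 2 :=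
        Finset.sum_le_sum_of_subset_of_nonneg (hM.trans (Finset.range_mono hN))
          fun _ _ _ => by positivity
    _ ≤ C ^ 2 * ∑ n ∈ Finset.range N, ‖x n‖ ^ 2 := hA.sum_norm_sq_apply_le hC N x
    _ ≤ C ^ 2 * ‖x‖ ^ 2 := by
        rw [← tsum_norm_sq_lp]
        gcongr
        exact (summable_norm_sq_lp x).sum_le_tsum _ fun _ _ => by positivity
    _ = _ := by ring

/-- A matrix with a bounded form is the matrix of a bounded operator on `ℓ²`. -/
lemma FormBound.exists_clm {A : ℕ → ℕ → ℂ} {C : ℝ} (hC : 0 < C) (hA : FormBound A C) :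
    ∃ T : lp (fun _ : ℕ => ℂ) 2 →L[ℂ] lp (fun _ : ℕ => ℂ) 2, ‖T‖ ≤ C ∧
      ∀ m n : ℕ, inner ℂ (lp.single 2 m (1 : ℂ)) (T (lp.single 2 n (1 : ℂ))) = A m n := by
  have hmem (x : lp (fun _ : ℕ => ℂ) 2) : Memℓp (fun m => ∑' n, A m n * x n) 2 :=
    memℓp_gen' (C := (C * ‖x‖) ^ 2) fun S => by
      simpa using hA.sum_norm_sq_tsum_le hC x S
  let L : lp (fun _ : ℕ => ℂ) 2 →ₗ[ℂ] lp (fun _ : ℕ => ℂ) 2 :=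
    { toFun := fun x => ⟨fun m => ∑' n, A m n * x n, hmem x⟩
      map_add' := fun x y => by
        ext m
        simp only [lp.coeFn_add, Pi.add_apply, mul_add]
        exact (hA.summable_mul hC m x).tsum_add (hA.summable_mul hC m y)
      map_smul' := fun c x => by
        ext m
        simp only [lp.coeFn_smul, Pi.smul_apply, smul_eq_mul, RingHom.id_apply, mul_left_comm _ c]
        exact tsum_mul_left }
  have hL (x : lp (fun _ : ℕ => ℂ) 2) : ‖L x‖ ≤ C * ‖x‖ :=
    lp.norm_le_of_forall_sum_le (by norm_num) (by positivity) fun S => by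
      simpa [L] using hA.sum_norm_sq_tsum_le hC x S
  refine ⟨L.mkContinuous C hL, L.mkContinuous_norm_le hC.le hL, fun m n => ?_⟩
  rw [lp.inner_single_left, LinearMap.mkContinuous_apply]
  change inner ℂ (1 : ℂ) (∑' k, A m k * (lp.single 2 n (1 : ℂ) : lp (fun _ : ℕ => ℂ) 2) k) = _
  rw [tsum_eq_single n fun k hk => by rw [lp.single_apply_ne _ _ _ hk, mul_zero],
    lp.single_apply_self]
  simp

lemma formBound_Qmat (s : ℝ) (hs : s ≠ 0) : FormBound (Qmat s) (Real.pi / 2 + 12 * |s|) := by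
  set c : ℂ := Complex.I * (Real.sign s : ℝ) with hcdef
  have hc : ‖c‖ = 1 := by
    rcases Real.sign_apply_eq_of_ne_zero s hs with h | h <;> simp [hcdef, h]
  have h1 := formBound_hilbert.const_mul (c / 2)
  have h2 : FormBound
      (fun m n => -c * (((1 - gammaRatio s m n) / (2 * ((n : ℝ) - m)) : ℝ) : ℂ)) (12 * |s|) := by
    refine FormBound.of_schur (K := fun m n => |s| * rootKernel m n)
      (p := fun n => (quarticRoot n ^ 2)⁻¹)
      (fun n => inv_pos.2 (pow_pos (quarticRoot_pos n) 2))
      (fun m n => by rw [rootKernel_comm]) (fun m n => ?_) (fun m N => ?_)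
    · rw [norm_mul, norm_neg, hc, one_mul, Complex.norm_real]
      exact one_sub_gammaRatio_div_le s m n
    · simp_rw [mul_assoc, ← Finset.mul_sum]
      have := mul_le_mul_of_nonneg_left (sum_rootKernel_mul_le m N) (abs_nonneg s)
      linarith
  have h := h1.add h2
  rw [norm_div, hc, show 1 / ‖(2 : ℂ)‖ * Real.pi = Real.pi / 2 by norm_num; ring] at h
  convert h using 1
  funext m n
  unfold Qmat
  split_ifs with hmn
  · simp [hmn]
  · have hne : (n : ℂ) - m ≠ 0 := sub_ne_zero.2 (by exact_mod_cast Ne.symm hmn)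
    change c / _ * ((gammaRatio s m n : ℝ) : ℂ) = _
    push_cast
    field_simp
    ring

/-- For every real `s ≠ 0`, the matrix `Q(s)` defines a bounded linear
operator on `ℓ²(ℕ∪{0})` with `‖Q(s)‖ ≤ π/2 + 12|s| + (1/2)|s|(1+|s|)^{(3+|s|)/2}`. -/
theorem stmt_13 (s : ℝ) (hs : s ≠ 0) :
    ∃ T : lp (fun _ : ℕ => ℂ) 2 →L[ℂ] lp (fun _ : ℕ => ℂ) 2,
      ‖T‖ ≤ Real.pi / 2 + 12 * |s| + (1 / 2) * |s| * (1 + |s|) ^ ((3 + |s|) / 2) ∧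
      ∀ m n : ℕ,
        @inner ℂ _ _ (lp.single 2 m (1 : ℂ)) (T (lp.single 2 n (1 : ℂ))) =
          Qmat s m n := by
  obtain ⟨T, hT, hinner⟩ := (formBound_Qmat s hs).exists_clm (by positivity)
  refine ⟨T, hT.trans (le_add_of_nonneg_right (by positivity)), hinner⟩
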